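/- arXiv:1703.05655 — 2 statements merged into one kernel-verified Lean document; each statement's English description precedes it below -/
import Mathlib

section
/- Let T be a rooted chain complete tree, endowed with the coarse wedge topology. If T has a retractional skeleton, then T satisfies condition (*) (every t ∈ T with cf(t) ≥ ω₁ has at most finitely many immediate successors), and moreover the set induced by any retractional skeleton on T equals D = {t ∈ T : cf(t) ≤ ω}. -/
open Cardinal Ordinal Filter Set Topology

universe u v

section TreeDefs

variable {T : Type u} [PartialOrder T]

/-- `T` is a tree: the set of strict predecessors of every point is well-ordered by `<`. -/
def IsTreeOrder (T : Type u) [PartialOrder T] : Prop :=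
  ∀ x : T, IsWellOrder {y : T // y < x} (· < ·)

/-- Every chain has a supremum. -/
def ChainComplete (T : Type u) [PartialOrder T] : Prop :=
  ∀ c : Set T, IsChain (· ≤ ·) c → ∃ s, IsLUB c s

open Classical in
/-- The height `ht(x,T)` of `x`: the order type of the set of its strict predecessors. -/
noncomputable def htx (x : T) : Ordinal.{u} :=
  if h : IsWellOrder {y : T // y < x} (· < ·) then @Ordinal.type {y : T // y < x} (· < ·) h
  else 0

/-- The cofinality `cf(x)` of `ht(x,T)`. -/
noncomputable def cfx (x : T) : Cardinal.{u} := (htx x).cof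

/-- `x` lies on a successor level. -/
def SuccLevel (x : T) : Prop := ∃ β : Ordinal, htx x = β + 1

/-- The set of immediate successors of `x`. -/
def ims (x : T) : Set T := {y | x < y ∧ htx y = htx x + 1}

/-- The wedge `V_t = {s : t ≤ s}`. -/
def Vset (t : T) : Set T := {s | t ≤ s}

/-- Condition (*): every `t` with `cf(t) ≥ ω₁` has finitely many immediate successors. -/
def StarCond (T : Type u) [PartialOrder T] : Prop :=
  ∀ t : T, Cardinal.aleph 1 ≤ cfx t → (ims t).Finite

/-- The coarse wedge topology: generated by the sets `V_t` and their complements,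
for `t` minimal or on a successor level. -/
def coarseWedge (T : Type u) [PartialOrder T] : TopologicalSpace T :=
  TopologicalSpace.generateFrom
    {U : Set T | ∃ t : T, (IsMin t ∨ SuccLevel t) ∧ (U = Vset t ∨ U = (Vset t)ᶜ)}

open Classical in
/-- `s ∧ t = max (ŝ ∩ t̂)`, the largest common predecessor (when it exists). -/
noncomputable def wedge (s t : T) : T :=
  if h : ∃ m, IsGreatest {r : T | r ≤ s ∧ r ≤ t} m then h.choose else s

open Classical in
/-- `ψ(t) = ims(t)` if `cf(t) ≥ ω₁`, and `ψ(t) = {0}` (the root) otherwise. -/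
noncomputable def psiSet (root : T) (t : T) : Set T :=
  if Cardinal.aleph 1 ≤ cfx t then ims t else {root}

/-- `φ` is a choice function assigning to every `t` with `cf(t) = ω` a sequence of
successor-level elements strictly below `t` converging to `t`, and the constant
sequence at the root otherwise. -/
def PhiSpec [TopologicalSpace T] (root : T) (φ : T → ℕ → T) : Prop :=
  ∀ t : T,
    (cfx t ≠ Cardinal.aleph0 → ∀ n, φ t n = root) ∧
    (cfx t = Cardinal.aleph0 →
      (∀ n, φ t n < t ∧ SuccLevel (φ t n)) ∧ Tendsto (φ t) atTop (nhds t))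

/-- Membership in the family `𝒜(T)`: countable subsets containing the root, closed
under `∧`, `φ` and `ψ`. -/
structure Admissible (root : T) (φ : T → ℕ → T) (A : Set T) : Prop where
  countable : A.Countable
  root_mem : root ∈ A
  wedge_mem : ∀ s ∈ A, ∀ t ∈ A, wedge s t ∈ A
  phi_mem : ∀ t ∈ A, ∀ n, φ t n ∈ A
  psi_mem : ∀ t ∈ A, psiSet root t ⊆ A

/-- The height of the tree `T`: the least `α` such that the level `α` of `T` is empty. -/
noncomputable def treeHeight (T : Type u) [PartialOrder T] : Ordinal.{u} :=
  sInf {α : Ordinal | ∀ x : T, htx x ≠ α}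

end TreeDefs

/-- A retractional skeleton on a compact space `K`: a family of continuous retractions
with metrizable compact ranges, indexed by an up-directed partially ordered set,
commuting under the order, continuous under countable increasing suprema, and
converging pointwise to the identity. -/
structure RetractionalSkeleton (K : Type v) [TopologicalSpace K] where
  Γ : Type v
  [po : PartialOrder Γ]
  [ne : Nonempty Γ]
  directed : ∀ s t : Γ, ∃ u, s ≤ u ∧ t ≤ u
  r : Γ → K → K
  cont : ∀ s, Continuous (r s)
  retraction : ∀ s x, r s (r s x) = r s x
  compact_range : ∀ s, IsCompact (Set.range (r s))
  metrizable_range : ∀ s, TopologicalSpace.MetrizableSpace (Set.range (r s))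
  comm : ∀ s t : Γ, s ≤ t → ∀ x, r s (r t x) = r s x ∧ r t (r s x) = r s x
  seq_sup : ∀ s : ℕ → Γ, Monotone s → ∃ t : Γ, IsLUB (Set.range s) t ∧
      ∀ x, Tendsto (fun n => r (s n) x) atTop (nhds (r t x))
  net_conv : ∀ x : K, Tendsto (fun s : Γ => r s x) atTop (nhds x)

/-- The subset induced by a retractional skeleton: `D = ⋃ₛ rₛ[K]`. -/
def RetractionalSkeleton.inducedSet {K : Type v} [TopologicalSpace K]
    (R : RetractionalSkeleton K) : Set K :=
  ⋃ s : R.Γ, Set.range (R.r s)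

/-- `A` is a `Σ`-subset of `K`: for some homeomorphic injection `h` of `K` into a cube
`[0,1]^Γ`, `h(A) = h(K) ∩ Σ(Γ)`. -/
def IsSigmaSubset {K : Type v} [TopologicalSpace K] (A : Set K) : Prop :=
  ∃ (Γ : Type v) (h : K → Γ → Set.Icc (0 : ℝ) 1),
    Topology.IsEmbedding h ∧
      h '' A = Set.range h ∩ {x | {γ | (x γ : ℝ) ≠ 0}.Countable}

/-- `K` is a Valdivia compact space: it has a dense `Σ`-subset. -/
def IsValdivia (K : Type v) [TopologicalSpace K] : Prop :=
  ∃ A : Set K, Dense A ∧ IsSigmaSubset A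

/-- The bounded topology on a product `∏_{α<ω₁} X_α`: basic open sets are the sets
`V(g,β) = {f : f↾β = g↾β}` for `β < ω₁`. -/
def boundedTopology (X : Set.Iio (Cardinal.aleph 1).ord → Type v) :
    TopologicalSpace (∀ α, X α) :=
  TopologicalSpace.generateFrom
    {U | ∃ (g : ∀ α, X α) (β : Ordinal), β < (Cardinal.aleph 1).ord ∧
      U = {f | ∀ α : Set.Iio (Cardinal.aleph 1).ord, (α : Ordinal) < β → f α = g α}}

section TreeOrder

variable {T : Type u} [PartialOrder T]

theorem IsTreeOrder.le_total_of_le (htree : IsTreeOrder T) {x y t : T} (hx : x ≤ t) (hy : y ≤ t) :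
    x ≤ y ∨ y ≤ x := by
  rcases hx.eq_or_lt with rfl | hx
  · exact .inr hy
  rcases hy.eq_or_lt with rfl | hy
  · exact .inl hx.le
  have := htree t
  rcases trichotomous_of (· < ·) (⟨x, hx⟩ : {y : T // y < t}) ⟨y, hy⟩ with h | h | h
  · exact .inl (le_of_lt h)
  · exact .inl (congrArg Subtype.val h).le
  · exact .inr (le_of_lt h)

theorem IsTreeOrder.wellFoundedLT_Iio (htree : IsTreeOrder T) (t : T) :
    WellFoundedLT {y : T // y < t} :=
  ⟨(htree t).wf⟩

open Classical in
/-- The predecessors of a point of a tree, as a linear order. -/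
@[reducible] noncomputable def IsTreeOrder.linearOrderIio (htree : IsTreeOrder T) (t : T) :
    LinearOrder {y : T // y < t} :=
  { (inferInstance : PartialOrder {y : T // y < t}) with
    le_total := fun x y => htree.le_total_of_le x.2.le y.2.le
    toDecidableLE := Classical.decRel _ }

theorem IsTreeOrder.htx_eq_type (htree : IsTreeOrder T) (t : T) :
    htx t = @Ordinal.type {y : T // y < t} (· < ·) (htree t) :=
  dif_pos (htree t)

theorem IsTreeOrder.htx_strictMono (htree : IsTreeOrder T) : StrictMono (htx (T := T)) := by
  intro x y h
  rw [htree.htx_eq_type, htree.htx_eq_type]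
  have := htree x
  have := htree y
  refine PrincipalSeg.ordinal_type_lt
    ⟨⟨⟨fun z => ⟨z.1, z.2.trans h⟩, @fun a b hab => ?_⟩, Iff.rfl⟩, ⟨x, h⟩, fun b => ⟨?_, ?_⟩⟩
  · exact Subtype.ext (Subtype.mk.inj hab)
  · rintro ⟨z, rfl⟩
    exact z.2
  · exact fun hb => ⟨⟨b.1, hb⟩, rfl⟩

theorem IsTreeOrder.covBy_of_mem_ims (htree : IsTreeOrder T) {x y : T} (h : y ∈ ims x) :
    x ⋖ y := by
  refine ⟨h.1, fun z hxz hzy => ?_⟩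
  have h₁ := htree.htx_strictMono hxz
  have h₂ := htree.htx_strictMono hzy
  rw [h.2, ← Order.succ_eq_add_one, Order.lt_succ_iff] at h₂
  exact h₂.not_gt h₁

theorem IsTreeOrder.succLevel_iff (htree : IsTreeOrder T) {y : T} :
    SuccLevel y ↔ ∃ x, x ⋖ y := by
  let := htree.linearOrderIio y
  have := htree.wellFoundedLT_Iio y
  have key := Ordinal.type_lt_mem_range_succ_iff (α := {x : T // x < y})
  have h₁ : SuccLevel y ↔ htx y ∈ Set.range (Order.succ : Ordinal → Ordinal) :=
    exists_congr fun β => by rw [Order.succ_eq_add_one, eq_comm]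
  rw [h₁, htree.htx_eq_type]
  refine key.trans ⟨?_, ?_⟩
  · rintro ⟨x, hx⟩
    exact ⟨x, x.2, fun z hxz hzy => hxz.not_ge (hx (b := ⟨z, hzy⟩) hxz.le)⟩
  · rintro ⟨x, hx⟩
    refine ⟨⟨x, hx.lt⟩, fun z hz => ?_⟩
    exact not_lt_iff_le_imp_ge.1 (fun h => hx.2 h z.2) hz

theorem IsTreeOrder.cfx_le_aleph0_iff (htree : IsTreeOrder T) {t : T} :
    cfx t ≤ Cardinal.aleph0 ↔
      ∃ S : Set T, S.Countable ∧ (∀ z ∈ S, z < t) ∧ ∀ y < t, ∃ z ∈ S, y ≤ z := by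
  let := htree.linearOrderIio t
  have := htree.wellFoundedLT_Iio t
  have h₁ : cfx t = Order.cof {y : T // y < t} := by
    rw [cfx, htree.htx_eq_type]
    exact Ordinal.cof_type _
  rw [h₁]
  constructor
  · intro h
    obtain ⟨S, hS, hc⟩ := Order.exists_cof_eq {y : T // y < t}
    refine ⟨Subtype.val '' S, ?_, ?_, ?_⟩
    · exact (Cardinal.le_aleph0_iff_set_countable.1 (hc.trans_le h)).image _
    · rintro _ ⟨z, -, rfl⟩
      exact z.2
    · intro y hy
      obtain ⟨z, hz, hyz⟩ := hS ⟨y, hy⟩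
      exact ⟨z, ⟨z, hz, rfl⟩, hyz⟩
  · rintro ⟨S, hc, hS, hcof⟩
    refine (Order.cof_le (s := Subtype.val ⁻¹' S) ?_).trans
      (Cardinal.le_aleph0_iff_set_countable.2 (hc.preimage Subtype.val_injective))
    intro y
    obtain ⟨z, hz, hyz⟩ := hcof y y.2
    exact ⟨⟨z, hS z hz⟩, hz, hyz⟩

theorem IsTreeOrder.exists_covBy_le (htree : IsTreeOrder T) {x t : T} (h : x < t) :
    ∃ y, x ⋖ y ∧ y ≤ t := by
  by_cases hne : ∃ z, x < z ∧ z < t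
  · obtain ⟨z, hxz, hzt⟩ := hne
    obtain ⟨m, hm, hmin⟩ := (htree t).wf.has_min {z | x < z.1} ⟨⟨z, hzt⟩, hxz⟩
    exact ⟨m, ⟨hm, fun w hxw hwm => hmin ⟨w, hwm.trans m.2⟩ hxw hwm⟩, m.2.le⟩
  · exact ⟨t, ⟨h, fun z hxz hzt => hne ⟨z, hxz, hzt⟩⟩, le_rfl⟩

theorem IsTreeOrder.le_of_covBy (htree : IsTreeOrder T) {x y z t : T} (h : x ⋖ y) (hy : y ≤ t)
    (hz : z ≤ t) (hxz : x < z) : y ≤ z := by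
  rcases htree.le_total_of_le hy hz with h' | h'
  · exact h'
  · rcases h'.eq_or_lt with rfl | h'
    · exact le_rfl
    · exact (h.2 hxz h').elim

/-- The points whose wedge is a subbasic clopen set of the coarse wedge topology. -/
def IsAnchor (t : T) : Prop := IsMin t ∨ SuccLevel t

theorem IsTreeOrder.isAnchor_of_covBy (htree : IsTreeOrder T) {x y : T} (h : x ⋖ y) :
    IsAnchor y :=
  .inr (htree.succLevel_iff.2 ⟨x, h⟩)

theorem IsTreeOrder.cfx_le_aleph0_of_isAnchor (htree : IsTreeOrder T) {t : T} (h : IsAnchor t) :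
    cfx t ≤ Cardinal.aleph0 := by
  rw [htree.cfx_le_aleph0_iff]
  rcases h with h | h
  · exact ⟨∅, countable_empty, by simp, fun y hy => (h.not_lt hy).elim⟩
  · obtain ⟨x, hx⟩ := htree.succLevel_iff.1 h
    refine ⟨{x}, countable_singleton x, by simpa using hx.lt, fun y hy => ⟨x, rfl, ?_⟩⟩
    rcases htree.le_total_of_le hy.le hx.le with h | h
    · exact h
    · rcases h.eq_or_lt with rfl | h
      · exact le_rfl
      · exact (hx.2 h hy).elim

/-- An anchor below a least upper bound of a chain lies below a member of the chain. -/
theorem IsTreeOrder.exists_le_of_isLUB (htree : IsTreeOrder T) {C : Set T} {x p : T}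
    (hne : C.Nonempty) (hx : IsLUB C x) (hp : IsAnchor p) (hpx : p ≤ x) : ∃ c ∈ C, p ≤ c := by
  by_contra! hcon
  have hlt : ∀ c ∈ C, c < p := fun c hc =>
    ((htree.le_total_of_le hpx (hx.1 hc)).resolve_left (hcon c hc)).lt_of_ne
      (fun h => hcon c hc h.ge)
  rcases hp with hp | hp
  · obtain ⟨c, hc⟩ := hne
    exact hp.not_lt (hlt c hc)
  · obtain ⟨q, hq⟩ := htree.succLevel_iff.1 hp
    have : x ≤ q := hx.2 fun c hc => by
      rcases htree.le_total_of_le (hlt c hc).le hq.le with h | h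
      · exact h
      · rcases h.eq_or_lt with rfl | h
        · exact le_rfl
        · exact (hq.2 h (hlt c hc)).elim
    exact (hq.lt.trans_le hpx).not_ge this

theorem IsTreeOrder.exists_isAnchor_not_le (htree : IsTreeOrder T) (hcc : ChainComplete T)
    {x y : T} (h : ¬ x ≤ y) : ∃ p, IsAnchor p ∧ p ≤ x ∧ ¬ p ≤ y := by
  by_contra! hcon
  have hx : ¬ IsAnchor x := fun hx => h (hcon x hx le_rfl)
  have hlt : ∀ z < x, z ≤ y := fun z hz => by
    obtain ⟨w, hw, hwx⟩ := htree.exists_covBy_le hz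
    exact hw.le.trans (hcon w (htree.isAnchor_of_covBy hw) hwx)
  obtain ⟨s, hs⟩ := hcc (Iio x) fun a ha b hb _ => htree.le_total_of_le (le_of_lt ha) (le_of_lt hb)
  have hsx : s ≤ x := hs.2 fun z hz => le_of_lt hz
  rcases hsx.eq_or_lt with rfl | hsx
  · exact h (hs.2 hlt)
  · refine hx (htree.isAnchor_of_covBy (x := s) ⟨hsx, fun z hsz hzx => ?_⟩)
    exact hsz.not_ge (hs.1 hzx)

end TreeOrder

section CoarseWedge

variable {T : Type u} [PartialOrder T]

theorem IsAnchor.isClopen_Vset [τ : TopologicalSpace T] (hτ : τ = coarseWedge T) {p : T}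
    (hp : IsAnchor p) : IsClopen (Vset p) := by
  have h₁ : IsOpen (Vset p) := by
    rw [hτ]
    exact .basic _ ⟨p, hp, .inl rfl⟩
  have h₂ : IsOpen (Vset p)ᶜ := by
    rw [hτ]
    exact .basic _ ⟨p, hp, .inr rfl⟩
  exact ⟨⟨h₂⟩, h₁⟩

theorem IsTreeOrder.t2Space [τ : TopologicalSpace T] (hτ : τ = coarseWedge T)
    (htree : IsTreeOrder T) (hcc : ChainComplete T) : T2Space T := by
  have key : ∀ x y : T, ¬ x ≤ y → ∃ u v : Set T, IsOpen u ∧ IsOpen v ∧ x ∈ u ∧ y ∈ v ∧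
      Disjoint u v := fun x y h => by
    obtain ⟨p, hp, hpx, hpy⟩ := htree.exists_isAnchor_not_le hcc h
    have := hp.isClopen_Vset hτ
    exact ⟨_, _, this.isOpen, this.compl.isOpen, hpx, hpy, disjoint_compl_right⟩
  refine ⟨fun x y hxy => ?_⟩
  by_cases h : x ≤ y
  · obtain ⟨u, v, hu, hv, hx, hy, hd⟩ := key y x fun h' => hxy (h.antisymm h')
    exact ⟨v, u, hv, hu, hy, hx, hd.symm⟩
  · exact key x y h

/-- Every neighbourhood of `x` contains a wedge at an anchor below `x` minus the wedges at
finitely many covers of `x`. -/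
theorem IsTreeOrder.exists_Vset_diff_subset [τ : TopologicalSpace T] (hτ : τ = coarseWedge T)
    (htree : IsTreeOrder T) (hcc : ChainComplete T) {root : T} (hroot : ∀ x : T, root ≤ x)
    {U : Set T} (hU : IsOpen U) {x : T} (hx : x ∈ U) :
    ∃ p, IsAnchor p ∧ p ≤ x ∧ ∃ F : Set T, F.Finite ∧ (∀ s ∈ F, x ⋖ s) ∧
      ∀ y, p ≤ y → (∀ s ∈ F, ¬ s ≤ y) → y ∈ U := by
  subst hτ
  have hroot' : IsAnchor root := .inl fun y _ => hroot y
  induction hU with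
  | basic U hU =>
    obtain ⟨q, hq, rfl | rfl⟩ := hU
    · exact ⟨q, hq, hx, ∅, finite_empty, by simp, fun y hy _ => hy⟩
    · have hqx : ¬ q ≤ x := hx
      by_cases hxq : x ≤ q
      · obtain ⟨s, hs, hsq⟩ := htree.exists_covBy_le (hxq.lt_of_ne fun h => hqx h.ge)
        exact ⟨root, hroot', hroot x, {s}, finite_singleton s, by simpa using hs,
          fun y _ hy hqy => hy s rfl (hsq.trans hqy)⟩
      · obtain ⟨p, hp, hpx, hpq⟩ := htree.exists_isAnchor_not_le hcc hxq
        refine ⟨p, hp, hpx, ∅, finite_empty, by simp, fun y hy _ hqy => ?_⟩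
        rcases htree.le_total_of_le hy hqy with h | h
        · exact hpq h
        · exact hqx (h.trans hpx)
  | univ => exact ⟨root, hroot', hroot x, ∅, finite_empty, by simp, fun _ _ _ => mem_univ _⟩
  | inter U V _ _ ihU ihV =>
    obtain ⟨p, hp, hpx, F, hF, hFc, hpF⟩ := ihU hx.1
    obtain ⟨q, hq, hqx, G, hG, hGc, hqG⟩ := ihV hx.2
    have hFG : ∀ s ∈ F ∪ G, x ⋖ s := fun s hs => hs.elim (hFc s) (hGc s)
    rcases htree.le_total_of_le hpx hqx with h | h
    · exact ⟨q, hq, hqx, F ∪ G, hF.union hG, hFG, fun y hy hs =>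
        ⟨hpF y (h.trans hy) fun s h => hs s (.inl h), hqG y hy fun s h => hs s (.inr h)⟩⟩
    · exact ⟨p, hp, hpx, F ∪ G, hF.union hG, hFG, fun y hy hs =>
        ⟨hpF y hy fun s h => hs s (.inl h), hqG y (h.trans hy) fun s h => hs s (.inr h)⟩⟩
  | sUnion 𝒰 _ ih =>
    obtain ⟨U, hU, hxU⟩ := hx
    obtain ⟨p, hp, hpx, F, hF, hFc, hpF⟩ := ih U hU hxU
    exact ⟨p, hp, hpx, F, hF, hFc, fun y hy hs => ⟨U, hU, hpF y hy hs⟩⟩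

end CoarseWedge

namespace RetractionalSkeleton

section General

variable {K : Type v} [TopologicalSpace K] (R : RetractionalSkeleton K)

theorem mem_inducedSet {x : K} : x ∈ R.inducedSet ↔ ∃ s, R.r s x = x := by
  simp only [inducedSet, mem_iUnion, mem_range]
  refine exists_congr fun s => ⟨?_, fun h => ⟨x, h⟩⟩
  rintro ⟨y, rfl⟩
  exact R.retraction s y

theorem fixed_of_le {s t : R.Γ} (h : R.po.le s t) {x : K} (hx : R.r s x = x) : R.r t x = x := by
  have := (R.comm s t h x).2
  rwa [hx] at this

theorem exists_mem_inducedSet {U : Set K} (hU : IsOpen U) (hne : U.Nonempty) :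
    ∃ d ∈ U, d ∈ R.inducedSet := by
  let := R.po
  have := R.ne
  have : IsDirectedOrder R.Γ := ⟨R.directed⟩
  obtain ⟨x, hx⟩ := hne
  obtain ⟨s, hs⟩ := ((R.net_conv x).eventually (hU.mem_nhds hx)).exists
  exact ⟨R.r s x, hs, R.mem_inducedSet.2 ⟨s, R.retraction s x⟩⟩

theorem exists_forall_fixed {C : Set K} (hC : C.Countable) (hCD : C ⊆ R.inducedSet) :
    ∃ s, ∀ x ∈ C, R.r s x = x := by
  let := R.po
  have := R.ne
  rcases C.eq_empty_or_nonempty with rfl | hne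
  · exact ⟨Classical.arbitrary _, by simp⟩
  obtain ⟨f, rfl⟩ := hC.exists_eq_range hne
  choose s hs using fun n => R.mem_inducedSet.1 (hCD (mem_range_self n))
  choose ub hub₁ hub₂ using R.directed
  let t : ℕ → R.Γ := fun n => Nat.rec (s 0) (fun n u => ub u (s (n + 1))) n
  have hst : ∀ n, s n ≤ t n := fun n => by
    cases n with
    | zero => exact le_rfl
    | succ n => exact hub₂ _ _
  obtain ⟨u, hu, -⟩ := R.seq_sup t (monotone_nat_of_le_succ fun n => hub₁ _ _)
  refine ⟨u, ?_⟩
  rintro _ ⟨n, rfl⟩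
  exact R.fixed_of_le ((hst n).trans (hu.1 (mem_range_self n))) (hs n)

theorem isClosed_fixed [T2Space K] (s : R.Γ) : IsClosed {x | R.r s x = x} :=
  isClosed_eq (R.cont s) continuous_id

theorem mem_inducedSet_of_mem_closure [T2Space K] {C : Set K} (hC : C.Countable)
    (hCD : C ⊆ R.inducedSet) {x : K} (hx : x ∈ closure C) : x ∈ R.inducedSet := by
  obtain ⟨s, hs⟩ := R.exists_forall_fixed hC hCD
  exact R.mem_inducedSet.2 ⟨s, closure_minimal hs (R.isClosed_fixed s) hx⟩

theorem exists_isOpen_fiber (s : R.Γ) {x : K} (hx : R.r s x = x) :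
    ∃ U : ℕ → Set K, (∀ n, IsOpen (U n) ∧ x ∈ U n) ∧ ∀ y, (∀ n, y ∈ U n) → R.r s y = x := by
  have := R.metrizable_range s
  obtain ⟨V, hV, hVx⟩ := isGδ_iff_eq_iInter_nat.1
    (IsGδ.singleton (⟨R.r s x, mem_range_self x⟩ : range (R.r s)))
  refine ⟨fun n => rangeFactorization (R.r s) ⁻¹' V n, fun n => ⟨?_, ?_⟩, fun y hy => ?_⟩
  · exact (hV n).preimage ((R.cont s).subtype_mk _)
  · exact mem_iInter.1 (hVx.subset (mem_singleton _)) n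
  · have : rangeFactorization (R.r s) y = ⟨R.r s x, mem_range_self x⟩ :=
      hVx.symm.subset (mem_iInter.2 hy)
    exact (congrArg Subtype.val this).trans hx

end General

section Tree

variable {T : Type u} [PartialOrder T] [τ : TopologicalSpace T] (R : RetractionalSkeleton T)

theorem mem_inducedSet_of_infinite_covBy (hτ : τ = coarseWedge T) (htree : IsTreeOrder T)
    (hcc : ChainComplete T) {root : T} (hroot : ∀ x : T, root ≤ x) {x : T}
    (hx : {y | x ⋖ y}.Infinite) : x ∈ R.inducedSet := by
  have := htree.t2Space hτ hcc
  have hd : ∀ n, ∃ d ∈ Vset (hx.natEmbedding _ n : T), d ∈ R.inducedSet := fun n =>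
    R.exists_mem_inducedSet
      ((htree.isAnchor_of_covBy (hx.natEmbedding _ n).2).isClopen_Vset hτ).isOpen ⟨_, le_refl _⟩
  choose d hd hdD using hd
  refine R.mem_inducedSet_of_mem_closure (countable_range d) (range_subset_iff.2 hdD) ?_
  refine mem_closure_iff.2 fun U hU hxU => ?_
  obtain ⟨p, -, hpx, F, hF, hFc, hpF⟩ := htree.exists_Vset_diff_subset hτ hcc hroot hU hxU
  obtain ⟨n, hn⟩ : ∃ n, (hx.natEmbedding _ n : T) ∉ F := by
    by_contra! hcon
    refine Set.infinite_range_of_injective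
      (Subtype.val_injective.comp (hx.natEmbedding _).injective) (hF.subset ?_)
    rintro _ ⟨n, rfl⟩
    exact hcon n
  have hxn : x ⋖ (hx.natEmbedding _ n : T) := (hx.natEmbedding _ n).2
  refine ⟨d n, hpF _ (hpx.trans (hxn.le.trans (hd n))) fun s hs hsd => hn ?_, mem_range_self n⟩
  have h₁ := htree.le_of_covBy hxn (hd n) hsd (hFc s hs).lt
  have h₂ := htree.le_of_covBy (hFc s hs) hsd (hd n) hxn.lt
  rwa [h₁.antisymm h₂]

theorem mem_inducedSet_of_cfx_le (hτ : τ = coarseWedge T) (htree : IsTreeOrder T)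
    (hcc : ChainComplete T) {root : T} (hroot : ∀ x : T, root ≤ x) {x : T}
    (hx : cfx x ≤ Cardinal.aleph0) : x ∈ R.inducedSet := by
  have := htree.t2Space hτ hcc
  by_cases hfin : {y | x ⋖ y}.Finite
  swap
  · exact R.mem_inducedSet_of_infinite_covBy hτ htree hcc hroot hfin
  obtain ⟨P, hP, hPx, hPc⟩ : ∃ P : Set T, P.Countable ∧ (∀ p ∈ P, IsAnchor p ∧ p ≤ x) ∧
      ∀ q, IsAnchor q → q ≤ x → ∃ p ∈ P, q ≤ p := by
    by_cases hxa : IsAnchor x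
    · exact ⟨{x}, countable_singleton x, by simpa using hxa, fun q _ hq => ⟨x, rfl, hq⟩⟩
    obtain ⟨S, hS, hSx, hSc⟩ := htree.cfx_le_aleph0_iff.1 hx
    have hsucc : ∀ z : S, ∃ y, (z : T) ⋖ y ∧ y ≤ x := fun z => htree.exists_covBy_le (hSx z z.2)
    choose g hg hgx using hsucc
    have := hS.to_subtype
    refine ⟨range g, countable_range g, ?_, fun q hq hqx => ?_⟩
    · rintro _ ⟨z, rfl⟩
      exact ⟨htree.isAnchor_of_covBy (hg z), hgx z⟩
    · obtain ⟨z, hz, hqz⟩ := hSc q (hqx.lt_of_ne fun h => hxa (h ▸ hq))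
      exact ⟨g ⟨z, hz⟩, mem_range_self _, hqz.trans (hg ⟨z, hz⟩).le⟩
  have hd : ∀ p : P, ∃ d ∈ Vset (p : T) ∩ ⋂ s ∈ {y | x ⋖ y}, (Vset s)ᶜ, d ∈ R.inducedSet := by
    refine fun p => R.exists_mem_inducedSet (IsOpen.inter ?_ ?_) ⟨x, (hPx p p.2).2, ?_⟩
    · exact ((hPx p p.2).1.isClopen_Vset hτ).isOpen
    · exact hfin.isOpen_biInter fun s hs =>
        ((htree.isAnchor_of_covBy hs).isClopen_Vset hτ).compl.isOpen
    · exact mem_iInter₂.2 fun s hs hsx => (CovBy.lt hs).not_ge hsx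
  choose d hd hdD using hd
  have := hP.to_subtype
  refine R.mem_inducedSet_of_mem_closure (countable_range d) (range_subset_iff.2 hdD) ?_
  refine mem_closure_iff.2 fun U hU hxU => ?_
  obtain ⟨q, hq, hqx, F, -, hFc, hqF⟩ := htree.exists_Vset_diff_subset hτ hcc hroot hU hxU
  obtain ⟨p, hp, hqp⟩ := hPc q hq hqx
  exact ⟨d ⟨p, hp⟩, hqF _ (hqp.trans (hd ⟨p, hp⟩).1) fun s hs =>
    mem_iInter₂.1 (hd ⟨p, hp⟩).2 s (hFc s hs), mem_range_self _⟩

theorem exists_lt_forall_fiber (hτ : τ = coarseWedge T) (htree : IsTreeOrder T)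
    (hcc : ChainComplete T) {root : T} (hroot : ∀ x : T, root ≤ x) {t : T}
    (ht : ¬ cfx t ≤ Cardinal.aleph0) {s : R.Γ} (hs : R.r s t = t) :
    ∃ a < t, ∀ y, a ≤ y → y ≤ t → R.r s y = t := by
  obtain ⟨U, hU, hUt⟩ := R.exists_isOpen_fiber s hs
  choose p hp hpt F _ hFc hpF using fun n =>
    htree.exists_Vset_diff_subset hτ hcc hroot (hU n).1 (hU n).2
  have hlt : ∀ n, p n < t := fun n => (hpt n).lt_of_ne fun h =>
    ht (htree.cfx_le_aleph0_of_isAnchor (h ▸ hp n))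
  rw [htree.cfx_le_aleph0_iff] at ht
  push Not at ht
  obtain ⟨a, hat, ha⟩ := ht (range p) (countable_range p) (forall_mem_range.2 hlt)
  refine ⟨a, hat, fun y hay hyt => hUt y fun n => hpF n y ?_ fun f hf hfy => ?_⟩
  · exact ((htree.le_total_of_le (hlt n).le hat.le).resolve_right
      (ha _ (mem_range_self n))).trans hay
  · exact (hFc n f hf).lt.not_ge (hfy.trans hyt)

theorem cfx_le_of_mem_inducedSet (hτ : τ = coarseWedge T) (htree : IsTreeOrder T)
    (hcc : ChainComplete T) {root : T} (hroot : ∀ x : T, root ≤ x) {t : T}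
    (htD : t ∈ R.inducedSet) : cfx t ≤ Cardinal.aleph0 := by
  by_contra ht
  have := htree.t2Space hτ hcc
  let := R.po
  obtain ⟨s₀, hs₀⟩ := R.mem_inducedSet.1 htD
  have hstep : ∀ q : {q : R.Γ × T // R.r q.1 t = t ∧ q.2 < t},
      ∃ q' : {q : R.Γ × T // R.r q.1 t = t ∧ q.2 < t}, q.1.1 ≤ q'.1.1 ∧ q.1.2 ≤ q'.1.2 ∧
        R.r q'.1.1 q'.1.2 = q'.1.2 ∧ ∀ y, q'.1.2 ≤ y → y ≤ t → R.r q.1.1 y = t := by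
    rintro ⟨⟨s, x⟩, hs, hx⟩
    obtain ⟨a, hat, ha⟩ := R.exists_lt_forall_fiber hτ htree hcc hroot ht hs
    obtain ⟨b, hb, hbx, hba⟩ : ∃ b < t, x ≤ b ∧ a ≤ b := by
      rcases htree.le_total_of_le hx.le hat.le with h | h
      · exact ⟨a, hat, h, le_rfl⟩
      · exact ⟨x, hx, le_rfl, h⟩
    obtain ⟨c, hbc, hct⟩ := htree.exists_covBy_le hb
    have hc := htree.cfx_le_aleph0_of_isAnchor (htree.isAnchor_of_covBy hbc)
    obtain ⟨s', hs'⟩ :=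
      R.mem_inducedSet.1 (R.mem_inducedSet_of_cfx_le hτ htree hcc hroot hc)
    obtain ⟨u, hsu, hsu'⟩ := R.directed s s'
    exact ⟨⟨⟨u, c⟩, R.fixed_of_le hsu hs, hct.lt_of_ne fun h => ht (h ▸ hc)⟩, hsu,
      hbx.trans hbc.le, R.fixed_of_le hsu' hs', fun y hy => ha y (hba.trans (hbc.le.trans hy))⟩
  choose next hn₁ hn₂ hn₃ hn₄ using hstep
  have hroot_lt : root < t := (hroot t).lt_of_ne fun h =>
    ht (htree.cfx_le_aleph0_of_isAnchor (.inl fun y _ => h ▸ hroot y))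
  let q : ℕ → {q : R.Γ × T // R.r q.1 t = t ∧ q.2 < t} :=
    fun n => next^[n] ⟨⟨s₀, root⟩, hs₀, hroot_lt⟩
  have hq : ∀ n, q (n + 1) = next (q n) := fun n => Function.iterate_succ_apply' _ _ _
  let s : ℕ → R.Γ := fun n => (q n).1.1
  let x : ℕ → T := fun n => (q (n + 1)).1.2
  have hsmono : Monotone s := monotone_nat_of_le_succ fun n => by
    simpa only [s, hq] using hn₁ (q n)
  have hxmono : Monotone x := monotone_nat_of_le_succ fun n => by
    simpa only [x, hq (n + 1)] using hn₂ (q (n + 1))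
  have hsx : ∀ n, R.r (s (n + 1)) (x n) = x n := fun n => by
    simpa only [s, x, hq] using hn₃ (q n)
  have hst : ∀ n y, x n ≤ y → y ≤ t → R.r (s n) y = t := fun n => by
    simpa only [s, x, hq] using hn₄ (q n)
  obtain ⟨z, hz⟩ := hcc (range x) hxmono.isChain_range
  have hzt : z < t := by
    rw [htree.cfx_le_aleph0_iff] at ht
    push Not at ht
    have hxt : ∀ n, x n < t := fun n => (q (n + 1)).2.2
    obtain ⟨a, hat, ha⟩ := ht (range x) (countable_range x) (forall_mem_range.2 hxt)
    exact (hz.2 (forall_mem_range.2 fun n => (htree.le_total_of_le (hxt n).le hat.le).resolve_right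
      (ha _ (mem_range_self n)))).trans_lt hat
  obtain ⟨w, hw, hwlim⟩ := R.seq_sup s hsmono
  have hwz : R.r w z = t := tendsto_nhds_unique (hwlim z) (by
    simp only [hst _ z (hz.1 (mem_range_self _)) hzt.le, tendsto_const_nhds_iff])
  have hzcl : z ∈ closure (range x) := by
    refine mem_closure_iff.2 fun U hU hzU => ?_
    obtain ⟨p, hp, hpz, F, -, hFc, hpF⟩ := htree.exists_Vset_diff_subset hτ hcc hroot hU hzU
    obtain ⟨c, hc, hpc⟩ := htree.exists_le_of_isLUB (range_nonempty x) hz hp hpz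
    exact ⟨c, hpF c hpc fun f hf hfc => (hFc f hf).lt.not_ge (hfc.trans (hz.1 hc)), hc⟩
  have hwx : range x ⊆ {y | R.r w y = y} := range_subset_iff.2 fun n =>
    R.fixed_of_le (hw.1 (mem_range_self (n + 1))) (hsx n)
  have hwz' : R.r w z = z := closure_minimal hwx (R.isClosed_fixed w) hzcl
  exact hzt.ne (hwz'.symm.trans hwz)

end Tree

end RetractionalSkeleton

theorem stmt1 {T : Type u} [PartialOrder T] [τ : TopologicalSpace T]
    (hτ : τ = coarseWedge T) (htree : IsTreeOrder T) (hcc : ChainComplete T)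
    (root : T) (hroot : ∀ x : T, root ≤ x)
    (R : RetractionalSkeleton T) :
    StarCond T ∧ R.inducedSet = {u : T | cfx u ≤ Cardinal.aleph0} := by
  refine ⟨fun t ht => ?_, Set.ext fun t => ⟨R.cfx_le_of_mem_inducedSet hτ htree hcc hroot,
    R.mem_inducedSet_of_cfx_le hτ htree hcc hroot⟩⟩
  by_contra hinf
  have hD := R.mem_inducedSet_of_infinite_covBy hτ htree hcc hroot
    (Set.Infinite.mono (fun y => htree.covBy_of_mem_ims) hinf)
  have h := ht.trans (R.cfx_le_of_mem_inducedSet hτ htree hcc hroot hD)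
  rw [← Cardinal.aleph_zero, Cardinal.aleph_le_aleph] at h
  exact zero_lt_one.not_ge h
end

section
/- Let T be a rooted chain complete tree satisfying condition (*), endowed with the coarse wedge topology, and let A ∈ 𝒜(T). If t ∈ cl(A) \ A, then cf(t) = ω; equivalently, every element of cl(A) that lies on a successor level, or has cf(t) ≥ ω₁, already belongs to A. -/
open Cardinal Ordinal Filter Set Topology

universe u v

section

variable {T : Type u} [PartialOrder T]

lemma IsTreeOrder.total_of_le (htree : IsTreeOrder T) {a b x : T} (ha : a ≤ x) (hb : b ≤ x) :
    a ≤ b ∨ b ≤ a := by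
  rcases ha.eq_or_lt with rfl | ha
  · exact .inr hb
  rcases hb.eq_or_lt with rfl | hb
  · exact .inl ha.le
  have := htree x
  rcases trichotomous_of (· < ·) (⟨a, ha⟩ : {y : T // y < x}) ⟨b, hb⟩ with h | h | h
  · exact .inl (le_of_lt h)
  · exact .inl (Subtype.ext_iff.1 h).le
  · exact .inr (le_of_lt h)

lemma IsTreeOrder.wellFoundedLT (htree : IsTreeOrder T) : WellFoundedLT T := by
  refine ⟨WellFounded.wellFounded_iff_has_min.2 fun S ⟨x, hx⟩ => ?_⟩
  by_cases hmin : ∃ y ∈ S, y < x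
  · obtain ⟨y, hyS, hyx⟩ := hmin
    have := htree x
    obtain ⟨⟨m, hmx⟩, hmS, hm⟩ := WellFounded.has_min
      (IsWellFounded.wf : WellFounded ((· < ·) : {y : T // y < x} → _ → Prop))
      {y | (y : T) ∈ S} ⟨⟨y, hyx⟩, hyS⟩
    exact ⟨m, hmS, fun z hz hzm => hm ⟨z, hzm.trans hmx⟩ hz hzm⟩
  · push Not at hmin
    exact ⟨x, hx, fun y hy => hmin y hy⟩

lemma cfx_eq_cof (htree : IsTreeOrder T) (x : T) : cfx x = Order.cof {y : T // y < x} := by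
  classical
  let : LinearOrder {y : T // y < x} :=
    { (inferInstance : PartialOrder {y : T // y < x}) with
      le_total := fun a b => htree.total_of_le a.2.le b.2.le
      toDecidableLE := Classical.decRel _ }
  have := htree x
  have : WellFoundedLT {y : T // y < x} := ⟨IsWellFounded.wf⟩
  rw [cfx, htx, dif_pos (htree x)]
  exact Ordinal.cof_type {y : T // y < x}

lemma succLevel_iff_cfx_eq_one (x : T) : SuccLevel x ↔ cfx x = 1 := by
  rw [cfx, Ordinal.cof_eq_one_iff]
  simp [SuccLevel, eq_comm]

lemma succLevel_of_isGreatest (htree : IsTreeOrder T) {p x : T} (hp : IsGreatest (Iio x) p) :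
    SuccLevel x := by
  rw [succLevel_iff_cfx_eq_one, cfx_eq_cof htree, Order.cof_eq_one_iff]
  exact ⟨⟨p, hp.1⟩, fun y => hp.2 y.2⟩

lemma exists_succLevel_between (htree : IsTreeOrder T) {a b : T} (hab : a < b) :
    ∃ s, a < s ∧ s ≤ b ∧ SuccLevel s := by
  have := htree.wellFoundedLT
  obtain ⟨s, ⟨has, hsb⟩, hs⟩ := WellFounded.has_min
    (IsWellFounded.wf : WellFounded ((· < ·) : T → T → Prop)) (Ioc a b) ⟨b, hab, le_rfl⟩
  refine ⟨s, has, hsb, succLevel_of_isGreatest htree (p := a) ⟨has, fun x hx => ?_⟩⟩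
  rcases htree.total_of_le has.le (le_of_lt hx) with h | h
  · rcases h.eq_or_lt with rfl | h
    · exact le_rfl
    · exact (hs x ⟨h, (le_of_lt hx).trans hsb⟩ hx).elim
  · exact h

lemma isGreatest_wedge (htree : IsTreeOrder T) (hcc : ChainComplete T) (s t : T) :
    IsGreatest {r : T | r ≤ s ∧ r ≤ t} (wedge s t) := by
  have h : ∃ m, IsGreatest {r : T | r ≤ s ∧ r ≤ t} m := by
    obtain ⟨m, hm⟩ := hcc {r : T | r ≤ s ∧ r ≤ t}
      fun a ha b hb _ => htree.total_of_le ha.1 hb.1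
    exact ⟨m, ⟨hm.2 fun _ h => h.1, hm.2 fun _ h => h.2⟩, hm.1⟩
  rw [wedge, dif_pos h]
  exact h.choose_spec

lemma exists_isLeast_of_wedge_mem (htree : IsTreeOrder T) (hcc : ChainComplete T) {A : Set T}
    (hA : ∀ s ∈ A, ∀ t ∈ A, wedge s t ∈ A) {t : T} (hne : (A ∩ Ici t).Nonempty) :
    ∃ m, IsLeast (A ∩ Ici t) m := by
  have := htree.wellFoundedLT
  obtain ⟨m, hm, hmin⟩ := WellFounded.has_min
    (IsWellFounded.wf : WellFounded ((· < ·) : T → T → Prop)) _ hne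
  refine ⟨m, hm, fun a ha => ?_⟩
  have hw := isGreatest_wedge htree hcc m a
  have hwm : wedge m a = m := hw.1.1.eq_of_not_lt
    (hmin _ ⟨hA _ hm.1 _ ha.1, hw.2 ⟨hm.2, ha.2⟩⟩)
  exact hwm ▸ hw.1.2

lemma exists_lt_of_countable (htree : IsTreeOrder T) {t : T} (ht : Cardinal.aleph 1 ≤ cfx t)
    {S : Set T} (hS : S.Countable) (hSt : S ⊆ Iio t) : ∃ p < t, ∀ a ∈ S, a < p := by
  have hncof : ¬ IsCofinal ((↑) ⁻¹' S : Set {y : T // y < t}) := fun h => by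
    have h1 := ht.trans ((cfx_eq_cof htree t).trans_le (Order.cof_le h))
    have h2 : ((↑) ⁻¹' S : Set {y : T // y < t}).Countable :=
      hS.preimage Subtype.val_injective
    exact (h1.trans h2.le_aleph0).not_gt Cardinal.aleph0_lt_aleph_one
  simp only [IsCofinal, not_forall, not_exists, not_and] at hncof
  obtain ⟨⟨p, hp⟩, hpS⟩ := hncof
  refine ⟨p, hp, fun a ha => ?_⟩
  have hpa : ¬ p ≤ a := hpS ⟨a, hSt ha⟩ ha
  exact lt_of_le_not_ge ((htree.total_of_le (hSt ha).le hp.le).resolve_right hpa) hpa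

lemma isOpen_Ici_of_succLevel [τ : TopologicalSpace T] (hτ : τ = coarseWedge T) {s : T}
    (hs : SuccLevel s) : IsOpen (Ici s) := by
  subst hτ
  exact TopologicalSpace.isOpen_generateFrom_of_mem ⟨s, .inr hs, .inl rfl⟩

lemma isOpen_compl_Ici_of_succLevel [τ : TopologicalSpace T] (hτ : τ = coarseWedge T) {s : T}
    (hs : SuccLevel s) : IsOpen (Ici s)ᶜ := by
  subst hτ
  exact TopologicalSpace.isOpen_generateFrom_of_mem ⟨s, .inr hs, .inr rfl⟩

/-- A point in the closure of a wedge-closed set belongs to the set as soon as some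
neighbourhood of the point meets the set only above the point. -/
lemma mem_of_mem_closure_of_inter_subset_Ici [τ : TopologicalSpace T] (hτ : τ = coarseWedge T)
    (htree : IsTreeOrder T) (hcc : ChainComplete T) {A : Set T}
    (hA : ∀ s ∈ A, ∀ t ∈ A, wedge s t ∈ A) {t : T} (ht : t ∈ closure A) {U : Set T}
    (hU : IsOpen U) (htU : t ∈ U) (hUA : A ∩ U ⊆ Ici t) : t ∈ A := by
  rw [mem_closure_iff] at ht
  obtain ⟨a, haU, haA⟩ := ht U hU htU
  obtain ⟨m, hm, hleast⟩ :=
    exists_isLeast_of_wedge_mem htree hcc hA ⟨a, haA, hUA ⟨haA, haU⟩⟩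
  rcases eq_or_lt_of_le (show t ≤ m from hm.2) with rfl | htm
  · exact hm.1
  obtain ⟨s, hts, hsm, hs⟩ := exists_succLevel_between htree htm
  obtain ⟨b, ⟨hbU, hbs⟩, hbA⟩ := ht (U ∩ (Ici s)ᶜ)
    (hU.inter (isOpen_compl_Ici_of_succLevel hτ hs)) ⟨htU, hts.not_ge⟩
  exact (hbs (hsm.trans (hleast ⟨hbA, hUA ⟨hbA, hbU⟩⟩))).elim

lemma mem_of_mem_closure_of_succLevel_or [τ : TopologicalSpace T] (hτ : τ = coarseWedge T)
    (htree : IsTreeOrder T) (hcc : ChainComplete T) {A : Set T} (hcount : A.Countable)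
    (hA : ∀ s ∈ A, ∀ t ∈ A, wedge s t ∈ A) {t : T} (ht : t ∈ closure A)
    (h : SuccLevel t ∨ Cardinal.aleph 1 ≤ cfx t) : t ∈ A := by
  rcases h with hs | hcf
  · exact mem_of_mem_closure_of_inter_subset_Ici hτ htree hcc hA ht
      (isOpen_Ici_of_succLevel hτ hs) self_mem_Ici inter_subset_right
  · obtain ⟨p, hpt, hp⟩ := exists_lt_of_countable htree hcf
      ((hcount.image fun a => wedge a t).mono inter_subset_left)
      (inter_subset_right (t := Iio t))
    obtain ⟨s, hps, hst, hs⟩ := exists_succLevel_between htree hpt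
    refine mem_of_mem_closure_of_inter_subset_Ici hτ htree hcc hA ht
      (isOpen_Ici_of_succLevel hτ hs) hst fun a ⟨haA, has⟩ => ?_
    have hw := isGreatest_wedge htree hcc a t
    by_contra hta
    have hlt : wedge a t < t := lt_of_le_of_ne hw.1.2 fun h => hta (h ▸ hw.1.1)
    have hwp := hp _ ⟨mem_image_of_mem _ haA, hlt⟩
    exact ((hw.2 ⟨has, hst⟩).trans_lt (hwp.trans hps)).false

lemma isMin_or_succLevel_or_aleph_one_le (htree : IsTreeOrder T) {t : T}
    (ht : cfx t ≠ Cardinal.aleph0) :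
    IsMin t ∨ SuccLevel t ∨ Cardinal.aleph 1 ≤ cfx t := by
  rcases lt_or_gt_of_ne ht with h | h
  · rw [cfx, Ordinal.cof_lt_aleph0_iff, Cardinal.le_one_iff] at h
    rcases h with h | h
    · rw [← cfx, cfx_eq_cof htree, Order.cof_eq_zero_iff] at h
      exact .inl (isMin_iff_forall_not_lt.2 fun y hy => h.elim ⟨y, hy⟩)
    · exact .inr (.inl ((succLevel_iff_cfx_eq_one t).2 h))
  · rw [← Cardinal.succ_aleph0]
    exact .inr (.inr (Order.succ_le_of_lt h))

end

theorem stmt5 {T : Type u} [PartialOrder T] [τ : TopologicalSpace T]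
    (hτ : τ = coarseWedge T) (htree : IsTreeOrder T) (hcc : ChainComplete T)
    (root : T) (hroot : ∀ x : T, root ≤ x)
    (hstar : StarCond T) (φ : T → ℕ → T) (hφ : PhiSpec root φ)
    (A : Set T) (hA : Admissible root φ A) :
    (∀ t ∈ closure A \ A, cfx t = Cardinal.aleph0) ∧
    (∀ t ∈ closure A, (SuccLevel t ∨ Cardinal.aleph 1 ≤ cfx t) → t ∈ A) := by
  have key : ∀ t ∈ closure A, (SuccLevel t ∨ Cardinal.aleph 1 ≤ cfx t) → t ∈ A := fun t ht =>
    mem_of_mem_closure_of_succLevel_or hτ htree hcc hA.countable hA.wedge_mem ht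
  refine ⟨fun t ⟨ht, htA⟩ => ?_, key⟩
  by_contra hcf
  rcases isMin_or_succLevel_or_aleph_one_le htree hcf with h | h
  · exact htA (h.eq_of_le (hroot t) ▸ hA.root_mem)
  · exact htA (key t ht h)
end
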